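/- Let f = (f11,f12,f22) be a symmetric 2-tensor field with C² components compactly supported in the open unit disk, and assume u1 = u2 (i.e. u1 = u2 = 1/√2). Then for every x ∈ ℝ², f11(x) = (1/(4·u2))·D_u D_v X_{e2}(Lf + Tf)(x) - (1/(2·u1))·D_u D_v X_{-e1}(Mf)(x), where X_{-e1} denotes the divergent beam transform in the direction -e1. -/

import Mathlib

open MeasureTheory

noncomputable section

/-- Rotation of a vector by 90 degrees: `w⊥ = (-w2, w1)`. -/
def perp (w : ℝ × ℝ) : ℝ × ℝ := (-w.2, w.1)

/-- Divergent beam transform `X_w h (x) = ∫_0^∞ h(x + t w) dt`. -/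
def Xray (w : ℝ × ℝ) (h : ℝ × ℝ → ℝ) (x : ℝ × ℝ) : ℝ :=
  ∫ t in Set.Ioi (0:ℝ), h (x + t • w)

/-- First moment divergent beam transform `X¹_w h (x) = ∫_0^∞ t·h(x + t w) dt`. -/
def Xray1 (w : ℝ × ℝ) (h : ℝ × ℝ → ℝ) (x : ℝ × ℝ) : ℝ :=
  ∫ t in Set.Ioi (0:ℝ), t * h (x + t • w)

/-- Directional derivative `D_w h = w1 ∂h/∂x1 + w2 ∂h/∂x2`. -/
def Dw (w : ℝ × ℝ) (h : ℝ × ℝ → ℝ) (x : ℝ × ℝ) : ℝ :=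
  fderiv ℝ h x w

/-- Partial derivative in the first coordinate. -/
def pdx (h : ℝ × ℝ → ℝ) : ℝ × ℝ → ℝ := Dw (1, 0) h

/-- Partial derivative in the second coordinate. -/
def pdy (h : ℝ × ℝ → ℝ) : ℝ × ℝ → ℝ := Dw (0, 1) h

/-- The open unit disk in ℝ². -/
def unitDisk : Set (ℝ × ℝ) := {x | x.1 ^ 2 + x.2 ^ 2 < 1}

/-- `⟨f, w²⟩ = f11 w1² + 2 f12 w1 w2 + f22 w2²`. -/
def proj2 (f11 f12 f22 : ℝ × ℝ → ℝ) (w : ℝ × ℝ) (x : ℝ × ℝ) : ℝ :=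
  f11 x * w.1 ^ 2 + 2 * f12 x * w.1 * w.2 + f22 x * w.2 ^ 2

/-- `⟨f, w ⊙ w⊥⟩ = -f11 w1 w2 + f12 (w1² - w2²) + f22 w1 w2`. -/
def projMix (f11 f12 f22 : ℝ × ℝ → ℝ) (w : ℝ × ℝ) (x : ℝ × ℝ) : ℝ :=
  -(f11 x) * w.1 * w.2 + f12 x * (w.1 ^ 2 - w.2 ^ 2) + f22 x * w.1 * w.2

/-- V-line transform of a scalar function. -/
def Vlt (u v : ℝ × ℝ) (h : ℝ × ℝ → ℝ) (x : ℝ × ℝ) : ℝ := Xray u h x + Xray v h x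

/-- Longitudinal V-line transform. -/
def Lf (u v : ℝ × ℝ) (f11 f12 f22 : ℝ × ℝ → ℝ) (x : ℝ × ℝ) : ℝ :=
  Xray u (proj2 f11 f12 f22 u) x + Xray v (proj2 f11 f12 f22 v) x

/-- Transverse V-line transform. -/
def Tf (u v : ℝ × ℝ) (f11 f12 f22 : ℝ × ℝ → ℝ) (x : ℝ × ℝ) : ℝ :=
  Xray u (proj2 f11 f12 f22 (perp u)) x + Xray v (proj2 f11 f12 f22 (perp v)) x

/-- Mixed V-line transform. -/
def Mf (u v : ℝ × ℝ) (f11 f12 f22 : ℝ × ℝ → ℝ) (x : ℝ × ℝ) : ℝ :=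
  Xray u (projMix f11 f12 f22 u) x + Xray v (projMix f11 f12 f22 v) x

/-- First moment longitudinal V-line transform. -/
def L1f (u v : ℝ × ℝ) (f11 f12 f22 : ℝ × ℝ → ℝ) (x : ℝ × ℝ) : ℝ :=
  Xray1 u (proj2 f11 f12 f22 u) x + Xray1 v (proj2 f11 f12 f22 v) x

/-- Integrating along two linearly independent directions `w`, `u` is convolution with the
indicator of a cone, up to normalization of the Haar measure. -/
theorem Xray_Xray_convolution {w u : ℝ × ℝ} (hdet : w.1 * u.2 - w.2 * u.1 ≠ 0) :
    ∃ (μ : Measure (ℝ × ℝ)) (f : ℝ × ℝ → ℝ), μ.IsAddHaarMeasure ∧ LocallyIntegrable f μ ∧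
      ∀ h : ℝ × ℝ → ℝ, Continuous h → HasCompactSupport h → ∀ x : ℝ × ℝ,
        IntegrableOn (fun t : ℝ => Xray u h (x + t • w)) (Set.Ioi 0) ∧
        Xray w (Xray u h) x =
          convolution f h (ContinuousLinearMap.lsmul ℝ ℝ) μ x := by
  let A : ℝ × ℝ →ₗ[ℝ] ℝ × ℝ :=
    -((LinearMap.fst ℝ ℝ ℝ).smulRight w + (LinearMap.snd ℝ ℝ ℝ).smulRight u)
  have hA : ∀ p : ℝ × ℝ, A p = -(p.1 • w + p.2 • u) := fun p => rfl
  have hinj : Function.Injective A := by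
    refine (injective_iff_map_eq_zero A).2 fun p hp => ?_
    rw [hA, neg_eq_zero] at hp
    have h1 : p.1 * w.1 + p.2 * u.1 = 0 := by simpa using congrArg Prod.fst hp
    have h2 : p.1 * w.2 + p.2 * u.2 = 0 := by simpa using congrArg Prod.snd hp
    ext
    · exact (mul_eq_zero.1 (show p.1 * (w.1 * u.2 - w.2 * u.1) = 0 by
        linear_combination u.2 * h1 - u.1 * h2)).resolve_right hdet
    · exact (mul_eq_zero.1 (show p.2 * (w.1 * u.2 - w.2 * u.1) = 0 by
        linear_combination w.1 * h2 - w.2 * h1)).resolve_right hdet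
  let e : (ℝ × ℝ) ≃L[ℝ] (ℝ × ℝ) :=
    (LinearEquiv.ofInjectiveEndo A hinj).toContinuousLinearEquiv
  have he : ∀ x p : ℝ × ℝ, x + p.1 • w + p.2 • u = x - e p := fun x p => by
    rw [show e p = -(p.1 • w + p.2 • u) from rfl, sub_neg_eq_add, add_assoc]
  let Q : Set (ℝ × ℝ) := Set.Ioi 0 ×ˢ Set.Ioi 0
  have hQ : MeasurableSet Q := measurableSet_Ioi.prod measurableSet_Ioi
  have hμ : (volume.map e : Measure (ℝ × ℝ)).IsAddHaarMeasure := e.isAddHaarMeasure_map volume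
  refine ⟨volume.map e, (e.symm ⁻¹' Q).indicator fun _ => 1, hμ,
    (locallyIntegrable_const 1).indicator (e.symm.continuous.measurable hQ), fun h hc hs x => ?_⟩
  have hint : Integrable (fun p : ℝ × ℝ => h (x + p.1 • w + p.2 • u)) := by
    refine Continuous.integrable_of_hasCompactSupport (by fun_prop) ?_
    have heq : (fun p : ℝ × ℝ => h (x + p.1 • w + p.2 • u)) =
        h ∘ e.toHomeomorph.trans (Homeomorph.subLeft x) :=
      funext fun p => congrArg h (he x p)
    rw [heq]
    exact hs.comp_homeomorph _
  have hintQ : Integrable (fun p : ℝ × ℝ => h (x + p.1 • w + p.2 • u))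
      ((volume.restrict (Set.Ioi 0)).prod (volume.restrict (Set.Ioi 0))) := by
    rw [Measure.prod_restrict]
    exact hint.integrableOn
  refine ⟨hintQ.integral_prod_left, ?_⟩
  have hprod := integral_prod _ hintQ
  rw [Measure.prod_restrict, ← integral_indicator hQ] at hprod
  refine hprod.symm.trans ?_
  refine Eq.trans ?_ (e.toHomeomorph.measurableEmbedding.integral_map _).symm
  refine integral_congr_ae (Filter.Eventually.of_forall fun p => ?_)
  by_cases hp : p ∈ Q <;> simp [hp, he]

theorem hasCompactSupport_Dw {h : ℝ × ℝ → ℝ} (hs : HasCompactSupport h) (a : ℝ × ℝ) :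
    HasCompactSupport (Dw a h) :=
  hs.fderiv_apply ℝ a

theorem contDiff_Dw {h : ℝ × ℝ → ℝ} {n m : WithTop ℕ∞} (hh : ContDiff ℝ n h) (hmn : m + 1 ≤ n)
    (a : ℝ × ℝ) : ContDiff ℝ m (Dw a h) :=
  (hh.fderiv_right hmn).clm_apply contDiff_const

theorem hasFDerivAt_Xray_Xray {w u : ℝ × ℝ} (hdet : w.1 * u.2 - w.2 * u.1 ≠ 0)
    {h : ℝ × ℝ → ℝ} (hh : ContDiff ℝ 1 h) (hs : HasCompactSupport h) (x : ℝ × ℝ) :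
    ∃ L : ℝ × ℝ →L[ℝ] ℝ, HasFDerivAt (Xray w (Xray u h)) L x ∧
      ∀ a, L a = Xray w (Xray u (Dw a h)) x := by
  obtain ⟨μ, f, hμ, hf, H⟩ := Xray_Xray_convolution hdet
  have key := hs.hasFDerivAt_convolution_right (ContinuousLinearMap.lsmul ℝ ℝ) hf hh x
  rw [← funext fun y => (H h hh.continuous hs y).2] at key
  refine ⟨_, key, fun a => ?_⟩
  rw [convolution_precompR_apply _ hf (hs.fderiv ℝ) (hh.continuous_fderiv one_ne_zero)]
  exact ((H _ (contDiff_Dw (m := 0) hh (by simp) a).continuous (hasCompactSupport_Dw hs a) x).2).symm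

theorem isClosedEmbedding_line {w : ℝ × ℝ} (hw : w ≠ 0) (x : ℝ × ℝ) :
    Topology.IsClosedEmbedding (fun t : ℝ => x + t • w) :=
  (Homeomorph.addLeft x).isClosedEmbedding.comp (isClosedEmbedding_smul_left hw)

theorem integrable_comp_line {h : ℝ × ℝ → ℝ} (hc : Continuous h) (hs : HasCompactSupport h)
    {w : ℝ × ℝ} (hw : w ≠ 0) (x : ℝ × ℝ) : Integrable (fun t : ℝ => h (x + t • w)) :=
  (hc.comp (isClosedEmbedding_line hw x).continuous).integrable_of_hasCompactSupport
    (hs.comp_isClosedEmbedding (isClosedEmbedding_line hw x))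

/-- The fundamental theorem of calculus along a ray. -/
theorem Xray_Dw_self {w : ℝ × ℝ} (hw : w ≠ 0) {h : ℝ × ℝ → ℝ} (hh : ContDiff ℝ 1 h)
    (hs : HasCompactSupport h) (x : ℝ × ℝ) : Xray w (Dw w h) x = -h x := by
  have hline : ContDiff ℝ 1 (fun t : ℝ => x + t • w) := by fun_prop
  have hd : ∀ t : ℝ, HasDerivAt (fun t : ℝ => h (x + t • w)) (Dw w h (x + t • w)) t := by
    intro t
    have h1 : HasDerivAt (fun t : ℝ => x + t • w) w t := by
      simpa using ((hasDerivAt_id t).smul_const w).const_add x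
    exact ((hh.differentiable one_ne_zero).differentiableAt.hasFDerivAt).comp_hasDerivAt t h1
  have := HasCompactSupport.integral_Ioi_deriv_eq (hh.comp hline)
    (hs.comp_isClosedEmbedding (isClosedEmbedding_line hw x)) 0
  simp only [Function.comp_def, zero_smul, add_zero] at this
  rw [← this]
  simp only [Xray, (hd _).deriv]

theorem Dw_comm {h : ℝ × ℝ → ℝ} (hh : ContDiff ℝ 2 h) (a b : ℝ × ℝ) :
    Dw a (Dw b h) = Dw b (Dw a h) := by
  ext x
  have hd : DifferentiableAt ℝ (fderiv ℝ h) x :=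
    ((hh.fderiv_right (m := 1) (by norm_num)).differentiable one_ne_zero).differentiableAt
  have hsymm := (hh.contDiffAt (x := x)).isSymmSndFDerivAt (by simp)
  have hD : ∀ c d : ℝ × ℝ, Dw c (Dw d h) x = fderiv ℝ (fderiv ℝ h) x c d := by
    intro c d
    have := fderiv_clm_apply hd (differentiableAt_const d)
    change fderiv ℝ (fun y => fderiv ℝ h y d) x c = _
    rw [this]
    simp
  rw [hD, hD, hsymm]

/-- Differentiating a combination `X_w (X_u g + c X_v g)` along `v`, then `u`, recovers `g` when
`w` is parallel to `v + c u`. -/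
theorem Dw_Dw_Xray {u v w : ℝ × ℝ} {c k : ℝ} (hu : w.1 * u.2 - w.2 * u.1 ≠ 0)
    (hv : w.1 * v.2 - w.2 * v.1 ≠ 0) (hk : v + c • u = k • w) {g : ℝ × ℝ → ℝ}
    (hg : ContDiff ℝ 2 g) (hs : HasCompactSupport g) (x : ℝ × ℝ) :
    Dw u (Dw v (Xray w (fun y => Xray u g y + c * Xray v g y))) x = k * g x := by
  have hu0 : u ≠ 0 := by rintro rfl; simp at hu
  have hv0 : v ≠ 0 := by rintro rfl; simp at hv
  have hw0 : w ≠ 0 := by rintro rfl; simp at hu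
  obtain ⟨_, _, -, -, Hu⟩ := Xray_Xray_convolution hu
  obtain ⟨_, _, -, -, Hv⟩ := Xray_Xray_convolution hv
  have hadd : ∀ {h : ℝ × ℝ → ℝ}, Continuous h → HasCompactSupport h →
      Xray w (fun y => Xray u h y + c * Xray v h y) =
        fun y => Xray w (Xray u h) y + c * Xray w (Xray v h) y := by
    intro h hh hc
    ext y
    have h2 : IntegrableOn (fun t : ℝ => c * Xray v h (y + t • w)) (Set.Ioi 0) :=
      (Hv h hh hc y).1.const_mul c
    simp only [Xray.eq_1 w]
    rw [integral_add (Hu h hh hc y).1 h2, integral_const_mul]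
  have hD : ∀ {h : ℝ × ℝ → ℝ}, ContDiff ℝ 1 h → HasCompactSupport h → ∀ a,
      Dw a (fun y => Xray w (Xray u h) y + c * Xray w (Xray v h) y) =
        fun y => Xray w (Xray u (Dw a h)) y + c * Xray w (Xray v (Dw a h)) y := by
    intro h hh hc a
    ext y
    obtain ⟨L, hL, hLa⟩ := hasFDerivAt_Xray_Xray hu hh hc y
    obtain ⟨M, hM, hMa⟩ := hasFDerivAt_Xray_Xray hv hh hc y
    have hLM : HasFDerivAt (fun y => Xray w (Xray u h) y + c * Xray w (Xray v h) y)
        (L + c • M) y := hL.add (hM.const_mul c)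
    rw [Dw, hLM.fderiv]
    simp [hLa, hMa]
  have hgD : ∀ a, ContDiff ℝ 1 (Dw a g) := contDiff_Dw hg (by norm_num)
  rw [hadd hg.continuous hs, hD (hg.of_le one_le_two) hs, hD (hgD v) (hasCompactSupport_Dw hs v)]
  beta_reduce
  rw [funext (Xray_Dw_self hu0 (hgD v) (hasCompactSupport_Dw hs v)), Dw_comm hg u v,
    funext (Xray_Dw_self hv0 (hgD u) (hasCompactSupport_Dw hs u))]
  have hI : ∀ a, IntegrableOn (fun t : ℝ => Dw a g (x + t • w)) (Set.Ioi 0) := fun a =>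
    (integrable_comp_line (hgD a).continuous (hasCompactSupport_Dw hs a) hw0 x).integrableOn
  have hfin : Xray w (Dw v g) x + c * Xray w (Dw u g) x = k * Xray w (Dw w g) x := by
    simp only [Xray]
    rw [← integral_const_mul, ← integral_const_mul, ← integral_add (hI v) ((hI u).const_mul c)]
    refine integral_congr_ae (Filter.Eventually.of_forall fun t => ?_)
    simpa [Dw] using congrArg (fderiv ℝ g (x + t • w)) hk
  rw [Xray_Dw_self hw0 (hg.of_le one_le_two) hs] at hfin
  have hneg : ∀ h : ℝ × ℝ → ℝ, Xray w (fun y => -h y) x = -Xray w h x := fun h => integral_neg _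
  rw [hneg, hneg]
  linarith

theorem hasCompactSupport_of_tsupport_subset_unitDisk {h : ℝ × ℝ → ℝ}
    (hs : tsupport h ⊆ unitDisk) : HasCompactSupport h := by
  refine (isCompact_closedBall (0 : ℝ × ℝ) 1).of_isClosed_subset (isClosed_tsupport h)
    (hs.trans fun x hx => ?_)
  have hx' : x.1 ^ 2 + x.2 ^ 2 < 1 := hx
  rw [mem_closedBall_zero_iff, Prod.norm_def, sup_le_iff, Real.norm_eq_abs, Real.norm_eq_abs,
    ← sq_le_one_iff_abs_le_one, ← sq_le_one_iff_abs_le_one]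
  constructor <;> nlinarith [sq_nonneg x.1, sq_nonneg x.2]

theorem stmt_8 (u1 u2 : ℝ) (hu1 : 0 < u1) (hu2 : 0 < u2) (huv : u1 ^ 2 + u2 ^ 2 = 1)
    (f11 f12 f22 : ℝ × ℝ → ℝ)
    (hf11 : ContDiff ℝ 2 f11) (hf12 : ContDiff ℝ 2 f12) (hf22 : ContDiff ℝ 2 f22)
    (hs11 : tsupport f11 ⊆ unitDisk) (hs12 : tsupport f12 ⊆ unitDisk)
    (hs22 : tsupport f22 ⊆ unitDisk)
    (hueq : u1 = u2) :
    ∀ x : ℝ × ℝ,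
      f11 x =
        (1 / (4 * u2)) *
            Dw (u1, u2) (Dw (-u1, u2) (Xray (0, 1) (fun y => Lf (u1, u2) (-u1, u2) f11 f12 f22 y + Tf (u1, u2) (-u1, u2) f11 f12 f22 y))) x -
          (1 / (2 * u1)) * Dw (u1, u2) (Dw (-u1, u2) (Xray (-1, 0) (Mf (u1, u2) (-u1, u2) f11 f12 f22))) x := by
  intro x
  subst hueq
  have hsq : u1 ^ 2 = 1 / 2 := by linarith
  have h11 := hasCompactSupport_of_tsupport_subset_unitDisk hs11
  have h12 := hasCompactSupport_of_tsupport_subset_unitDisk hs12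
  have h22 := hasCompactSupport_of_tsupport_subset_unitDisk hs22
  have hsum : (fun y => Lf (u1, u1) (-u1, u1) f11 f12 f22 y + Tf (u1, u1) (-u1, u1) f11 f12 f22 y) =
      fun y => Xray (u1, u1) (fun z => f11 z + f22 z) y +
        1 * Xray (-u1, u1) (fun z => f11 z + f22 z) y := by
    have hw : ∀ w : ℝ × ℝ, w.1 ^ 2 = 1 / 2 → w.2 ^ 2 = 1 / 2 → ∀ y,
        Xray w (proj2 f11 f12 f22 w) y + Xray w (proj2 f11 f12 f22 (perp w)) y =
          Xray w (fun z => f11 z + f22 z) y := by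
      intro w hw1 hw2 y
      have hw0 : w ≠ 0 := by rintro rfl; norm_num at hw1
      have hI : ∀ b : ℝ × ℝ, IntegrableOn (fun t : ℝ => proj2 f11 f12 f22 b (y + t • w))
          (Set.Ioi 0) := fun b =>
        ((((integrable_comp_line hf11.continuous h11 hw0 y).mul_const _).add
          ((((integrable_comp_line hf12.continuous h12 hw0 y).const_mul 2).mul_const _).mul_const
            _)).add ((integrable_comp_line hf22.continuous h22 hw0 y).mul_const _)).integrableOn
      simp only [Xray]
      rw [← integral_add (hI w) (hI (perp w))]
      congr 1 with t
      simp only [proj2, perp]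
      linear_combination (f11 (y + t • w) + f22 (y + t • w)) * (hw1 + hw2)
    ext y
    rw [← hw _ hsq hsq, ← hw _ (by simpa using hsq) hsq, Lf, Tf]
    ring
  have hmix : Mf (u1, u1) (-u1, u1) f11 f12 f22 =
      fun y => Xray (u1, u1) (fun z => 1 / 2 * (f22 z - f11 z)) y +
        (-1) * Xray (-u1, u1) (fun z => 1 / 2 * (f22 z - f11 z)) y := by
    ext y
    simp only [Mf, Xray, projMix]
    rw [neg_one_mul, ← integral_neg]
    congr 2 <;> ext t
    · linear_combination (f22 (y + t • (u1, u1)) - f11 (y + t • (u1, u1))) * hsq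
    · linear_combination (f11 (y + t • (-u1, u1)) - f22 (y + t • (-u1, u1))) * hsq
  have h0 : u1 ≠ 0 := hu1.ne'
  rw [hsum, hmix,
    Dw_Dw_Xray (k := 2 * u1) (by simpa) (by simpa) (by ext <;> simp; ring) (hf11.add hf22)
      (h11.add h22),
    Dw_Dw_Xray (k := 2 * u1) (by simpa) (by simpa) (by ext <;> simp; ring)
      (contDiff_const.mul (hf22.sub hf11)) ((h22.sub h11).mul_left)]
  field_simp
  ring
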